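/- Let {X_t} be a stationary Markov chain on a finite set A = {1,...,n} with doublet frequency vector μ ∈ M_s(A²) satisfying μ_{ij} > 0 for all i, j, and let φ(x_1^l) ∈ S_n be the empirical singleton measure. Then {φ(x_1^l)} satisfies the large deviation property with rate function J(φ) = inf{ D_c(ν‖μ) : ν ∈ M_s(A²), ν̄ = φ }: for every open Γ ⊆ S_n, −inf_{φ∈Γ} J(φ) ≤ liminf_{l→∞} (1/l) log Pr{φ(x_1^l) ∈ Γ}, and for every closed Γ ⊆ S_n, limsup_{l→∞} (1/l) log Pr{φ(x_1^l) ∈ Γ} ≤ −inf_{φ∈Γ} J(φ). -/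

import Mathlib

open Finset Filter

/-- The simplex `S_n` of probability vectors. -/
def simplex (n : ℕ) : Set (Fin n → ℝ) := {p | (∀ i, 0 ≤ p i) ∧ ∑ i, p i = 1}

/-- Marginal of a doublet distribution. -/
def marg {n : ℕ} (ν : Fin n → Fin n → ℝ) : Fin n → ℝ := fun i => ∑ j, ν i j

def IsProb2 {n : ℕ} (ν : Fin n → Fin n → ℝ) : Prop :=
  (∀ i j, 0 ≤ ν i j) ∧ ∑ i, ∑ j, ν i j = 1

def IsStat2 {n : ℕ} (ν : Fin n → Fin n → ℝ) : Prop :=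
  ∀ i, ∑ j, ν i j = ∑ j, ν j i

/-- The set `M_s(A²)` of stationary probability distributions on `A²`. -/
def Ms2 (n : ℕ) : Set (Fin n → Fin n → ℝ) := {ν | IsProb2 ν ∧ IsStat2 ν}

/-- Relative entropy of doublet distributions. -/
noncomputable def DKL2 {n : ℕ} (ν μ : Fin n → Fin n → ℝ) : ℝ :=
  ∑ i, ∑ j, ν i j * Real.log (ν i j / μ i j)

/-- Relative entropy of probability vectors. -/
noncomputable def DKL1 {n : ℕ} (p q : Fin n → ℝ) : ℝ := ∑ i, p i * Real.log (p i / q i)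

/-- Conditional relative entropy `D_c(ν‖μ) = D(ν‖μ) − D(ν̄‖μ̄)`. -/
noncomputable def Dc {n : ℕ} (ν μ : Fin n → Fin n → ℝ) : ℝ :=
  DKL2 ν μ - DKL1 (marg ν) (marg μ)

/-- Empirical singleton measure of a sample path of length `l = m+1`. -/
noncomputable def emp1 {n m : ℕ} (x : Fin (m+1) → Fin n) : Fin n → ℝ :=
  fun i => (∑ t : Fin (m+1), if x t = i then (1:ℝ) else 0) / (m+1)

/-- Markov chain law on paths of length `l = m+1`:
`Pr{X_1^l = x} = μ̄(x_1) ∏ μ(x_t x_{t+1})/μ̄(x_t)`. -/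
noncomputable def pathP {n : ℕ} (μ : Fin n → Fin n → ℝ) {m : ℕ} (x : Fin (m+1) → Fin n) : ℝ :=
  marg μ (x 0) * ∏ t : Fin m, (μ (x t.castSucc) (x t.succ) / marg μ (x t.castSucc))

open scoped Classical in
/-- `Pr{φ(x_1^l) ∈ Γ}` over paths of length `l = m+1`. -/
noncomputable def prEvent1 {n : ℕ} (μ : Fin n → Fin n → ℝ) (m : ℕ)
    (Γ : Set (Fin n → ℝ)) : ℝ :=
  ∑ x : Fin (m+1) → Fin n, if emp1 x ∈ Γ then pathP μ x else 0

/-- Extended-real logarithm, `elog p = −∞` for `p ≤ 0`. -/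
noncomputable def elog (p : ℝ) : EReal := if p ≤ 0 then ⊥ else ((Real.log p : ℝ) : EReal)

/-- The contraction-principle rate function
`J(φ) = inf { D_c(ν‖μ) : ν ∈ M_s(A²), ν̄ = φ }`. -/
noncomputable def Jrate {n : ℕ} (μ : Fin n → Fin n → ℝ) (φ : Fin n → ℝ) : EReal :=
  ⨅ ν ∈ {ν : Fin n → Fin n → ℝ | ν ∈ Ms2 n ∧ marg ν = φ}, ((Dc ν μ : ℝ) : EReal)

/-- ℓ¹ (total variation) distance on probability vectors. -/
def dist1v {n : ℕ} (p q : Fin n → ℝ) : ℝ := ∑ i, |p i - q i|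

def OpenInV {n : ℕ} (S Γ : Set (Fin n → ℝ)) : Prop :=
  ∀ ζ ∈ Γ, ∃ ε > 0, ∀ ξ ∈ S, dist1v ξ ζ < ε → ξ ∈ Γ

def ClosedInV {n : ℕ} (S Γ : Set (Fin n → ℝ)) : Prop := OpenInV S (S \ Γ)

/-- Transition kernel of a doublet distribution. -/
noncomputable def kern {n : ℕ} (ν : Fin n → Fin n → ℝ) : Fin n → Fin n → ℝ :=
  fun i j => ν i j / marg ν i

/-- Number of cyclic transitions from `i` to `j` along `x`. -/
def cycCount {n m : ℕ} (x : Fin (m+1) → Fin n) (i j : Fin n) : ℕ :=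
  #{t : Fin (m+1) | x t = i ∧ x (t + 1) = j}

/-- Cyclic empirical doublet measure. -/
noncomputable def cycEmp {n m : ℕ} (x : Fin (m+1) → Fin n) : Fin n → Fin n → ℝ :=
  fun i j => (cycCount x i j : ℝ) / (m+1)

/-- Weight of the closed path obtained from `x` by returning to its starting point. -/
noncomputable def cycWeight {n m : ℕ} (W : Fin n → Fin n → ℝ) (x : Fin (m+1) → Fin n) : ℝ :=
  ∏ t : Fin (m+1), W (x t) (x (t + 1))

section CyclicPaths

variable {n m : ℕ}

lemma sum_cyc_eq (x : Fin (m+1) → Fin n) (f : Fin n → Fin n → ℝ) :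
    ∑ t, f (x t) (x (t + 1)) = (m+1) * ∑ i, ∑ j, cycEmp x i j * f i j := by
  have h : ∀ t, f (x t) (x (t + 1)) =
      ∑ i, ∑ j, if x t = i ∧ x (t + 1) = j then f i j else 0 := by
    intro t
    simp [ite_and]
  have hm : (m:ℝ) + 1 ≠ 0 := by positivity
  simp_rw [h]
  rw [Finset.sum_comm, Finset.mul_sum]
  refine Finset.sum_congr rfl fun i _ => ?_
  rw [Finset.sum_comm, Finset.mul_sum]
  refine Finset.sum_congr rfl fun j _ => ?_
  rw [← Finset.sum_filter, Finset.sum_const, nsmul_eq_mul, cycEmp, cycCount]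
  field_simp

lemma marg_cycEmp (x : Fin (m+1) → Fin n) : marg (cycEmp x) = emp1 x := by
  have hm : (m:ℝ) + 1 ≠ 0 := by positivity
  funext k
  have h := sum_cyc_eq x (fun i _ => if i = k then 1 else 0)
  have h2 : ∑ i, ∑ j, cycEmp x i j * (if i = k then (1:ℝ) else 0) = marg (cycEmp x) k := by
    simp [marg]
  rw [h2] at h
  rw [emp1, h]
  field_simp

lemma cycEmp_mem_Ms2 (x : Fin (m+1) → Fin n) : cycEmp x ∈ Ms2 n := by
  have hm : (m:ℝ) + 1 ≠ 0 := by positivity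
  refine ⟨⟨fun i j => by unfold cycEmp; positivity, ?_⟩, fun k => ?_⟩
  · have h := sum_cyc_eq x (fun _ _ => 1)
    simp only [Finset.sum_const, Finset.card_univ, Fintype.card_fin, nsmul_eq_mul, mul_one,
      Nat.cast_add, Nat.cast_one] at h
    exact (mul_left_cancel₀ hm (by rw [mul_one]; exact h)).symm
  · have h1 := sum_cyc_eq x (fun i _ => if i = k then 1 else 0)
    have h2 := sum_cyc_eq x (fun _ j => if j = k then 1 else 0)
    have h3 : ∑ t, (if x (t + 1) = k then (1:ℝ) else 0) = ∑ t, if x t = k then (1:ℝ) else 0 :=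
      Equiv.sum_comp (Equiv.addRight (1 : Fin (m+1))) (fun t => if x t = k then (1:ℝ) else 0)
    have h4 := h1.symm.trans (h3.symm.trans h2)
    have h5 := mul_left_cancel₀ hm h4
    simpa using h5

lemma cycEmp_pos (x : Fin (m+1) → Fin n) (t : Fin (m+1)) : 0 < cycEmp x (x t) (x (t + 1)) := by
  have : 0 < cycCount x (x t) (x (t + 1)) := Finset.card_pos.2 ⟨t, by simp⟩
  unfold cycEmp
  positivity

lemma cycWeight_eq_exp (x : Fin (m+1) → Fin n) (W : Fin n → Fin n → ℝ)
    (hW : ∀ i j, 0 < cycEmp x i j → 0 < W i j) :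
    cycWeight W x = Real.exp ((m+1) * ∑ i, ∑ j, cycEmp x i j * Real.log (W i j)) := by
  rw [← sum_cyc_eq x (fun i j => Real.log (W i j)), Real.exp_sum]
  exact Finset.prod_congr rfl fun t _ => (Real.exp_log (hW _ _ (cycEmp_pos x t))).symm

lemma cycWeight_eq_mul (W : Fin n → Fin n → ℝ) (x : Fin (m+1) → Fin n) :
    cycWeight W x =
      (∏ t : Fin m, W (x t.castSucc) (x t.succ)) * W (x (Fin.last m)) (x 0) := by
  rw [cycWeight, Fin.prod_univ_castSucc, Fin.last_add_one]
  simp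

lemma sum_path_eq (W : Fin n → Fin n → ℝ) (hW : ∀ i, ∑ j, W i j = 1) (a : Fin n → ℝ) :
    ∑ x : Fin (m+1) → Fin n, a (x 0) * ∏ t : Fin m, W (x t.castSucc) (x t.succ) = ∑ i, a i := by
  induction m generalizing a with
  | zero =>
    rw [← (Equiv.funUnique (Fin 1) (Fin n)).symm.sum_comp]
    simp
  | succ m ih =>
    rw [← (Fin.consEquiv (fun _ => Fin n)).sum_comp, Fintype.sum_prod_type, Finset.sum_comm]
    have h : ∀ y : Fin (m+1) → Fin n,
        ∑ i, a ((Fin.consEquiv (fun _ => Fin n)) (i, y) 0) * ∏ t : Fin (m+1),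
          W ((Fin.consEquiv (fun _ => Fin n)) (i, y) t.castSucc)
            ((Fin.consEquiv (fun _ => Fin n)) (i, y) t.succ)
        = (fun j => ∑ i, a i * W i j) (y 0) * ∏ t : Fin m, W (y t.castSucc) (y t.succ) := by
      intro y
      rw [Finset.sum_mul]
      refine Finset.sum_congr rfl fun i _ => ?_
      rw [Fin.prod_univ_succ]
      simp [Fin.consEquiv, mul_assoc]
    refine (Finset.sum_congr rfl fun y _ => h y).trans ((ih fun j => ∑ i, a i * W i j).trans ?_)
    rw [Finset.sum_comm]
    simp [← Finset.mul_sum, hW]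

lemma sum_cycWeight_le (W : Fin n → Fin n → ℝ) (h0 : ∀ i j, 0 ≤ W i j)
    (hW : ∀ i, ∑ j, W i j = 1) :
    ∑ x : Fin (m+1) → Fin n, cycWeight W x ≤ n := by
  have h := sum_path_eq (m := m) W hW (fun _ => 1)
  simp only [one_mul, Finset.sum_const, Finset.card_univ, Fintype.card_fin, nsmul_eq_mul,
    mul_one] at h
  rw [← h]
  refine Finset.sum_le_sum fun x _ => ?_
  rw [cycWeight_eq_mul]
  refine mul_le_of_le_one_right (Finset.prod_nonneg fun t _ => h0 _ _) ?_
  rw [← hW (x (Fin.last m))]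
  exact Finset.single_le_sum (fun j _ => h0 _ j) (Finset.mem_univ _)

/-- Summing, over all paths, the maximal likelihood of the cyclic transition counts is at most
`n` times the number of possible count matrices. -/
lemma sum_cycWeight_type_le (W : (Fin n → Fin n → ℝ) → Fin n → Fin n → ℝ)
    (h0 : ∀ ξ ∈ Ms2 n, ∀ i j, 0 ≤ W ξ i j)
    (hW : ∀ ξ ∈ Ms2 n, ∀ i, ∑ j, W ξ i j = 1) :
    ∑ x : Fin (m+1) → Fin n, cycWeight (W (cycEmp x)) x ≤ ((m:ℝ)+2) ^ (n*n) * n := by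
  classical
  set T : Finset (Fin n → Fin n → ℝ) :=
    Finset.univ.image (fun x : Fin (m+1) → Fin n => cycEmp x)
  have hmem : ∀ ξ ∈ T, ξ ∈ Ms2 n := by
    intro ξ hξ
    obtain ⟨x, -, rfl⟩ := Finset.mem_image.1 hξ
    exact cycEmp_mem_Ms2 x
  have hnn : ∀ ξ ∈ T, ∀ x : Fin (m+1) → Fin n, 0 ≤ cycWeight (W ξ) x :=
    fun ξ hξ x => Finset.prod_nonneg fun t _ => h0 ξ (hmem ξ hξ) _ _
  have hcard : (T.card : ℝ) ≤ ((m:ℝ)+2) ^ (n*n) := by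
    have hsub : T ⊆ Finset.univ.image
        (fun (c : Fin n → Fin n → Fin (m+2)) i j => ((c i j : ℕ) : ℝ) / (m+1)) := by
      intro ξ hξ
      obtain ⟨x, -, rfl⟩ := Finset.mem_image.1 hξ
      refine Finset.mem_image.2 ⟨fun i j => ⟨cycCount x i j, ?_⟩, Finset.mem_univ _, rfl⟩
      exact Nat.lt_succ_of_le ((Finset.card_le_univ _).trans (by simp))
    have h1 := (Finset.card_le_card hsub).trans Finset.card_image_le
    have h2 : T.card ≤ (m+2) ^ (n*n) := by simpa [pow_mul] using h1
    exact_mod_cast h2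
  calc ∑ x : Fin (m+1) → Fin n, cycWeight (W (cycEmp x)) x
      ≤ ∑ x : Fin (m+1) → Fin n, ∑ ξ ∈ T, cycWeight (W ξ) x :=
        Finset.sum_le_sum fun x _ =>
          Finset.single_le_sum (f := fun ξ => cycWeight (W ξ) x) (fun ξ hξ => hnn ξ hξ x)
            (Finset.mem_image_of_mem _ (Finset.mem_univ x))
    _ = ∑ ξ ∈ T, ∑ x : Fin (m+1) → Fin n, cycWeight (W ξ) x := Finset.sum_comm
    _ ≤ ∑ ξ ∈ T, (n:ℝ) :=
        Finset.sum_le_sum fun ξ hξ =>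
          sum_cycWeight_le _ (h0 ξ (hmem ξ hξ)) (hW ξ (hmem ξ hξ))
    _ ≤ ((m:ℝ)+2) ^ (n*n) * n := by
        rw [Finset.sum_const, nsmul_eq_mul]
        gcongr

end CyclicPaths

section Entropy

variable {n : ℕ}

lemma le_marg {ξ : Fin n → Fin n → ℝ} (h : ∀ i j, 0 ≤ ξ i j) (i j : Fin n) :
    ξ i j ≤ marg ξ i :=
  Finset.single_le_sum (fun j _ => h i j) (Finset.mem_univ j)

lemma marg_pos {μ : Fin n → Fin n → ℝ} (hpos : ∀ i j, 0 < μ i j) (i : Fin n) : 0 < marg μ i :=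
  (hpos i i).trans_le (le_marg (fun i j => (hpos i j).le) i i)

lemma marg_le_one {ξ : Fin n → Fin n → ℝ} (h : ξ ∈ Ms2 n) (i : Fin n) : marg ξ i ≤ 1 := by
  rw [← h.1.2]
  exact Finset.single_le_sum (f := fun i => ∑ j, ξ i j)
    (fun i _ => Finset.sum_nonneg fun j _ => h.1.1 i j) (Finset.mem_univ i)

lemma marg_mem_simplex {ξ : Fin n → Fin n → ℝ} (h : ξ ∈ Ms2 n) : marg ξ ∈ simplex n :=
  ⟨fun i => Finset.sum_nonneg fun j _ => h.1.1 i j, h.1.2⟩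

lemma kern_pos {μ : Fin n → Fin n → ℝ} (hpos : ∀ i j, 0 < μ i j) (i j : Fin n) :
    0 < kern μ i j := div_pos (hpos i j) (marg_pos hpos i)

lemma sum_kern {μ : Fin n → Fin n → ℝ} (hpos : ∀ i j, 0 < μ i j) (i : Fin n) :
    ∑ j, kern μ i j = 1 := by
  simp only [kern]
  rw [← Finset.sum_div]
  exact div_self (marg_pos hpos i).ne'

lemma kern_le_one {μ : Fin n → Fin n → ℝ} (hpos : ∀ i j, 0 < μ i j) (i j : Fin n) :
    kern μ i j ≤ 1 := by
  rw [← sum_kern hpos i]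
  exact Finset.single_le_sum (fun j _ => (kern_pos hpos i j).le) (Finset.mem_univ j)

lemma Dc_eq_sum {ξ μ : Fin n → Fin n → ℝ} (hξ : ∀ i j, 0 ≤ ξ i j) (hpos : ∀ i j, 0 < μ i j) :
    Dc ξ μ = ∑ i, ∑ j, ξ i j * (Real.log (kern ξ i j) - Real.log (kern μ i j)) := by
  rw [Dc, DKL2, DKL1, ← Finset.sum_sub_distrib]
  refine Finset.sum_congr rfl fun i _ => ?_
  conv_lhs => rw [marg, Finset.sum_mul, ← Finset.sum_sub_distrib]
  refine Finset.sum_congr rfl fun j _ => ?_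
  rcases (hξ i j).eq_or_lt with h | h
  · simp [← h]
  · have hm : 0 < marg ξ i := h.trans_le (le_marg hξ i j)
    have hμ := marg_pos hpos i
    have e : ∑ j, ξ i j = marg ξ i := rfl
    rw [e, kern, kern, Real.log_div h.ne' (hpos i j).ne', Real.log_div hm.ne' hμ.ne',
      Real.log_div h.ne' hm.ne', Real.log_div (hpos i j).ne' hμ.ne']
    ring

lemma continuous_marg (i : Fin n) : Continuous fun ξ : Fin n → Fin n → ℝ => marg ξ i := by
  unfold marg
  fun_prop

lemma continuous_Dc {μ : Fin n → Fin n → ℝ} (hpos : ∀ i j, 0 < μ i j) :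
    Continuous fun ξ : Fin n → Fin n → ℝ => Dc ξ μ := by
  have key : ∀ {b : ℝ}, 0 < b → Continuous fun a : ℝ => a * Real.log (a / b) := by
    intro b hb
    have h : (fun a : ℝ => a * Real.log (a / b)) = fun a => a * Real.log a - a * Real.log b := by
      funext a
      rcases eq_or_ne a 0 with rfl | ha
      · simp
      · rw [Real.log_div ha hb.ne']
        ring
    rw [h]
    exact Real.continuous_mul_log.sub (by fun_prop)
  unfold Dc DKL2 DKL1
  refine Continuous.sub ?_ ?_
  · exact continuous_finsetSum _ fun i _ => continuous_finsetSum _ fun j _ =>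
      (key (hpos i j)).comp (by fun_prop : Continuous fun ξ : Fin n → Fin n → ℝ => ξ i j)
  · exact continuous_finsetSum _ fun i _ =>
      (key (marg_pos hpos i)).comp (continuous_marg i)

lemma isCompact_Ms2 : IsCompact (Ms2 n) := by
  have hc : IsClosed (Ms2 n) := by
    have : Ms2 n = (⋂ i, ⋂ j, {ξ : Fin n → Fin n → ℝ | 0 ≤ ξ i j}) ∩ {ξ | ∑ i, ∑ j, ξ i j = 1} ∩
        ⋂ i, {ξ | ∑ j, ξ i j = ∑ j, ξ j i} := by
      ext ξ
      simp [Ms2, IsProb2, IsStat2]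
    rw [this]
    refine (IsClosed.inter ?_ ?_).inter ?_
    · exact isClosed_iInter fun i => isClosed_iInter fun j =>
        isClosed_le continuous_const (by fun_prop)
    · exact isClosed_eq (by fun_prop) continuous_const
    · exact isClosed_iInter fun i => isClosed_eq (by fun_prop) (by fun_prop)
  refine (isCompact_Icc (a := (0 : Fin n → Fin n → ℝ)) (b := 1)).of_isClosed_subset hc ?_
  intro ξ hξ
  exact ⟨fun i j => hξ.1.1 i j, fun i j => (le_marg hξ.1.1 i j).trans (marg_le_one hξ i)⟩

/-- Two stationary distributions of a positive kernel coincide. -/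
lemma stationary_unique [Nonempty (Fin n)] {Q : Fin n → Fin n → ℝ} (hQ : ∀ i j, 0 < Q i j)
    {p q : Fin n → ℝ} (hq : ∀ i, 0 < q i)
    (hp1 : ∑ i, p i = 1) (hq1 : ∑ i, q i = 1)
    (hpQ : ∀ j, p j = ∑ i, p i * Q i j) (hqQ : ∀ j, q j = ∑ i, q i * Q i j) : p = q := by
  obtain ⟨k, hk⟩ := Finite.exists_max fun i => p i / q i
  set r := p k / q k with hr
  have hnn : ∀ i, 0 ≤ r * q i - p i := fun i => by
    have := (div_le_iff₀ (hq i)).1 (hk i)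
    linarith
  have hk0 : r * q k - p k = 0 := by
    rw [hr, div_mul_cancel₀ _ (hq k).ne', sub_self]
  have hsum : ∑ i, (r * q i - p i) * Q i k = 0 := by
    rw [← hk0, hpQ k, hqQ k, Finset.mul_sum, ← Finset.sum_sub_distrib]
    exact Finset.sum_congr rfl fun i _ => by ring
  have hz : ∀ i, p i = r * q i := fun i => by
    have h := (Finset.sum_eq_zero_iff_of_nonneg
      (fun i _ => mul_nonneg (hnn i) (hQ i k).le)).1 hsum i (Finset.mem_univ i)
    have := (mul_eq_zero.1 h).resolve_right (hQ i k).ne'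
    linarith
  have hr1 : r = 1 := by
    rw [← hp1, Finset.sum_congr rfl fun i _ => hz i, ← Finset.mul_sum, hq1, mul_one]
  funext i
  rw [hz i, hr1, one_mul]

lemma sub_lt_mul_log_sub {a b c : ℝ} (hc : 0 ≤ c) (hb : 0 < b) (ha : 0 ≤ a)
    (hac : a ≤ c) (hne : a ≠ c * b) :
    a - c * b < a * (Real.log (a / c) - Real.log b) := by
  rcases ha.eq_or_lt with rfl | ha
  · have : 0 < c * b := lt_of_le_of_ne (by positivity) hne
    linarith
  · have hc : 0 < c := ha.trans_le hac
    have h := Real.log_lt_sub_one_of_pos (x := c * b / a) (by positivity)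
      (by rw [Ne, div_eq_one_iff_eq ha.ne']; exact hne.symm)
    rw [Real.log_div (by positivity) ha.ne', Real.log_mul hc.ne' hb.ne'] at h
    rw [Real.log_div ha.ne' hc.ne']
    have h2 := mul_lt_mul_of_pos_left h ha
    have h3 : a * (c * b / a - 1) = c * b - a := by field_simp
    rw [h3] at h2
    linarith

lemma Dc_pos [Nonempty (Fin n)] {ξ ν : Fin n → Fin n → ℝ} (hξ : ξ ∈ Ms2 n) (hν : ν ∈ Ms2 n)
    (hpos : ∀ i j, 0 < ν i j) (hne : ξ ≠ ν) : 0 < Dc ξ ν := by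
  have hm := (marg_mem_simplex hξ).1
  have hlt : ∃ i j, ξ i j ≠ marg ξ i * kern ν i j := by
    by_contra! hall
    have hνk : ∀ i j, ν i j = marg ν i * kern ν i j := fun i j => by
      rw [kern, mul_div_cancel₀ _ (marg_pos hpos i).ne']
    have : marg ξ = marg ν := stationary_unique (kern_pos hpos) (marg_pos hpos) hξ.1.2 hν.1.2
      (fun j => (hξ.2 j).trans (Finset.sum_congr rfl fun i _ => hall i j))
      (fun j => (hν.2 j).trans (Finset.sum_congr rfl fun i _ => hνk i j))
    exact hne (funext fun i => funext fun j => by rw [hall i j, this, ← hνk i j])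
  have hle : ∀ i j, ξ i j - marg ξ i * kern ν i j ≤
      ξ i j * (Real.log (kern ξ i j) - Real.log (kern ν i j)) := fun i j => by
    by_cases h : ξ i j = marg ξ i * kern ν i j
    · rcases (hξ.1.1 i j).eq_or_lt with h0 | h0
      · rw [← h, ← h0]
        simp
      · have hmi : 0 < marg ξ i := h0.trans_le (le_marg hξ.1.1 i j)
        have : kern ξ i j = kern ν i j := by
          rw [kern, h, mul_div_cancel_left₀ _ hmi.ne']
        rw [this, ← h]
        simp
    · exact (sub_lt_mul_log_sub (hm i) (kern_pos hpos i j) (hξ.1.1 i j)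
        (le_marg hξ.1.1 i j) h).le
  have h0 : ∑ i, ∑ j, (ξ i j - marg ξ i * kern ν i j) = 0 := by
    refine Finset.sum_eq_zero fun i _ => ?_
    rw [Finset.sum_sub_distrib, ← Finset.mul_sum, sum_kern hpos, mul_one]
    exact sub_self _
  rw [Dc_eq_sum hξ.1.1 hpos, ← h0]
  obtain ⟨i, j, hij⟩ := hlt
  refine Finset.sum_lt_sum (fun i _ => Finset.sum_le_sum fun j _ => hle i j)
    ⟨i, Finset.mem_univ i, Finset.sum_lt_sum (fun j _ => hle i j) ⟨j, Finset.mem_univ j, ?_⟩⟩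
  exact sub_lt_mul_log_sub (hm i) (kern_pos hpos i j) (hξ.1.1 i j) (le_marg hξ.1.1 i j) hij

/-- A nonnegative doublet distribution admits a stochastic kernel agreeing with its transition
probabilities wherever it charges. -/
lemma exists_stochastic_kern {ξ : Fin n → Fin n → ℝ} (hξ : ∀ i j, 0 ≤ ξ i j) :
    ∃ W : Fin n → Fin n → ℝ, (∀ i j, 0 ≤ W i j) ∧ (∀ i, ∑ j, W i j = 1) ∧
      ∀ i j, 0 < ξ i j → W i j = kern ξ i j := by
  have hm : ∀ i, 0 ≤ marg ξ i := fun i => Finset.sum_nonneg fun j _ => hξ i j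
  refine ⟨fun i j => if marg ξ i = 0 then (if j = i then 1 else 0) else kern ξ i j,
    fun i j => ?_, fun i => ?_, fun i j h => ?_⟩
  · have : 0 ≤ kern ξ i j := div_nonneg (hξ i j) (hm i)
    dsimp only
    split_ifs <;> simp [this]
  · by_cases h : marg ξ i = 0
    · simp [h]
    · simp only [h, if_false, kern]
      rw [← Finset.sum_div]
      exact div_self h
  · exact if_neg (h.trans_le (le_marg hξ i j)).ne'

end Entropy

section Bounds

variable {n : ℕ}

open scoped Classical in
/-- Probability that the cyclic empirical doublet measure lies in `S`. -/
noncomputable def prCyc (μ : Fin n → Fin n → ℝ) (m : ℕ) (S : Set (Fin n → Fin n → ℝ)) : ℝ :=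
  ∑ x : Fin (m+1) → Fin n, if cycEmp x ∈ S then pathP μ x else 0

lemma prEvent1_eq_prCyc (μ : Fin n → Fin n → ℝ) (m : ℕ) (Γ : Set (Fin n → ℝ)) :
    prEvent1 μ m Γ = prCyc μ m {ξ | marg ξ ∈ Γ} := by
  refine Finset.sum_congr rfl fun x _ => ?_
  by_cases h : emp1 x ∈ Γ
  · have h' : cycEmp x ∈ {ξ | marg ξ ∈ Γ} := by rwa [Set.mem_ofPred_eq, marg_cycEmp]
    rw [if_pos h, if_pos h']
  · have h' : cycEmp x ∉ {ξ | marg ξ ∈ Γ} := by rwa [Set.mem_ofPred_eq, marg_cycEmp]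
    rw [if_neg h, if_neg h']

lemma pathP_nonneg {μ : Fin n → Fin n → ℝ} (hpos : ∀ i j, 0 < μ i j) {m : ℕ}
    (x : Fin (m+1) → Fin n) : 0 ≤ pathP μ x :=
  mul_nonneg (marg_pos hpos _).le (Finset.prod_nonneg fun _ _ => (kern_pos hpos _ _).le)

lemma prCyc_add_compl {μ : Fin n → Fin n → ℝ} (hμ : μ ∈ Ms2 n) (hpos : ∀ i j, 0 < μ i j)
    (m : ℕ) (S : Set (Fin n → Fin n → ℝ)) : prCyc μ m S + prCyc μ m Sᶜ = 1 := by
  rw [prCyc, prCyc, ← Finset.sum_add_distrib, ← (marg_mem_simplex hμ).2,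
    ← sum_path_eq (m := m) (kern μ) (sum_kern hpos) (marg μ)]
  refine Finset.sum_congr rfl fun x _ => ?_
  by_cases h : cycEmp x ∈ S <;> simp [h, pathP, kern]

lemma exists_pos_le_cycWeight [Nonempty (Fin n)] {μ : Fin n → Fin n → ℝ}
    (hpos : ∀ i j, 0 < μ i j) :
    ∃ a > 0, ∀ (m : ℕ) (x : Fin (m+1) → Fin n), a * cycWeight (kern μ) x ≤ pathP μ x := by
  obtain ⟨k, hk⟩ := Finite.exists_min (marg μ)
  refine ⟨marg μ k, marg_pos hpos k, fun m x => ?_⟩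
  rw [cycWeight_eq_mul]
  have h0 : 0 ≤ ∏ t : Fin m, kern μ (x t.castSucc) (x t.succ) :=
    Finset.prod_nonneg fun _ _ => (kern_pos hpos _ _).le
  exact mul_le_mul (hk _) (mul_le_of_le_one_right h0 (kern_le_one hpos _ _))
    (mul_nonneg h0 (kern_pos hpos _ _).le) (marg_pos hpos _).le

lemma exists_pos_mul_pathP_le [Nonempty (Fin n)] {μ : Fin n → Fin n → ℝ} (hμ : μ ∈ Ms2 n)
    (hpos : ∀ i j, 0 < μ i j) :
    ∃ a > 0, ∀ (m : ℕ) (x : Fin (m+1) → Fin n), a * pathP μ x ≤ cycWeight (kern μ) x := by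
  obtain ⟨k, hk⟩ := Finite.exists_min fun p : Fin n × Fin n => kern μ p.1 p.2
  refine ⟨kern μ k.1 k.2, kern_pos hpos _ _, fun m x => ?_⟩
  rw [cycWeight_eq_mul, mul_comm]
  have h0 : 0 ≤ ∏ t : Fin m, kern μ (x t.castSucc) (x t.succ) :=
    Finset.prod_nonneg fun _ _ => (kern_pos hpos _ _).le
  exact mul_le_mul (mul_le_of_le_one_left h0 (marg_le_one hμ _)) (hk (_, _))
    (kern_pos hpos _ _).le h0

lemma exists_prCyc_le [Nonempty (Fin n)] {μ : Fin n → Fin n → ℝ} (hμ : μ ∈ Ms2 n)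
    (hpos : ∀ i j, 0 < μ i j) :
    ∃ C > 0, ∀ (m : ℕ) (S : Set (Fin n → Fin n → ℝ)) (c : ℝ),
      (∀ ξ ∈ Ms2 n, ξ ∈ S → c ≤ Dc ξ μ) →
        prCyc μ m S ≤ C * ((m:ℝ)+2) ^ (n*n) * Real.exp (-((m+1) * c)) := by
  obtain ⟨a, ha, hb⟩ := exists_pos_mul_pathP_le hμ hpos
  have hn : 0 < (n:ℝ) := by exact_mod_cast Fin.pos_iff_nonempty.2 ‹_›
  refine ⟨a⁻¹ * n, by positivity, fun m S c hc => ?_⟩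
  have hex : ∀ ξ : Fin n → Fin n → ℝ, ∃ W : Fin n → Fin n → ℝ, ξ ∈ Ms2 n →
      (∀ i j, 0 ≤ W i j) ∧ (∀ i, ∑ j, W i j = 1) ∧
        ∀ i j, 0 < ξ i j → W i j = kern ξ i j := fun ξ => by
    by_cases h : ξ ∈ Ms2 n
    · obtain ⟨W, hW⟩ := exists_stochastic_kern h.1.1
      exact ⟨W, fun _ => hW⟩
    · exact ⟨0, fun h' => absurd h' h⟩
  choose W hW using hex
  have hbound := sum_cycWeight_type_le (m := m) W (fun ξ hξ => (hW ξ hξ).1)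
    (fun ξ hξ => (hW ξ hξ).2.1)
  have hterm : ∀ x : Fin (m+1) → Fin n, cycEmp x ∈ S →
      pathP μ x ≤ a⁻¹ * Real.exp (-((m+1) * c)) * cycWeight (W (cycEmp x)) x := fun x hx => by
    have hM := cycEmp_mem_Ms2 x
    have hWx := (hW _ hM).2.2
    have hD : Dc (cycEmp x) μ = ∑ i, ∑ j, cycEmp x i j * Real.log (W (cycEmp x) i j)
        - ∑ i, ∑ j, cycEmp x i j * Real.log (kern μ i j) := by
      rw [Dc_eq_sum hM.1.1 hpos, ← Finset.sum_sub_distrib]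
      refine Finset.sum_congr rfl fun i _ => ?_
      rw [← Finset.sum_sub_distrib]
      refine Finset.sum_congr rfl fun j _ => ?_
      rcases (hM.1.1 i j).eq_or_lt with h | h
      · simp [← h]
      · rw [hWx i j h]
        ring
    have hcD := hc _ hM hx
    rw [cycWeight_eq_exp x (W (cycEmp x)) fun i j h => by
      rw [hWx i j h]
      exact div_pos h (h.trans_le (le_marg hM.1.1 i j)), mul_assoc, ← Real.exp_add,
      inv_mul_eq_div, le_div_iff₀ ha, mul_comm]
    refine (hb m x).trans ?_
    rw [cycWeight_eq_exp x (kern μ) fun i j _ => kern_pos hpos i j, Real.exp_le_exp]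
    have hm : (0:ℝ) ≤ m + 1 := by positivity
    have := mul_le_mul_of_nonneg_left hcD hm
    rw [hD] at this
    linarith
  have hnn : ∀ x : Fin (m+1) → Fin n, 0 ≤ cycWeight (W (cycEmp x)) x := fun x =>
    Finset.prod_nonneg fun _ _ => (hW _ (cycEmp_mem_Ms2 x)).1 _ _
  calc prCyc μ m S
      ≤ ∑ x : Fin (m+1) → Fin n,
          a⁻¹ * Real.exp (-((m+1) * c)) * cycWeight (W (cycEmp x)) x := by
        refine Finset.sum_le_sum fun x _ => ?_
        split_ifs with h
        · exact hterm x h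
        · have := hnn x
          positivity
    _ ≤ a⁻¹ * Real.exp (-((m+1) * c)) * (((m:ℝ)+2) ^ (n*n) * n) := by
        rw [← Finset.mul_sum]
        gcongr
    _ = _ := by ring

lemma tendsto_log_div (N : ℕ) (b : ℝ) :
    Tendsto (fun m : ℕ => ((m:ℝ)+1)⁻¹ * (b + N * Real.log ((m:ℝ)+2))) atTop (nhds 0) := by
  have hx : Tendsto (fun m : ℕ => (m:ℝ)+1) atTop atTop :=
    tendsto_atTop_add_const_right _ _ tendsto_natCast_atTop_atTop
  have hy : Tendsto (fun m : ℕ => (m:ℝ)+2) atTop atTop :=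
    tendsto_atTop_add_const_right _ _ tendsto_natCast_atTop_atTop
  have hlog : Tendsto (fun m : ℕ => Real.log ((m:ℝ)+2) / ((m:ℝ)+1)) atTop (nhds 0) := by
    have h := (Real.tendsto_pow_log_div_mul_add_atTop 1 (-1) 1 one_ne_zero).comp hy
    refine h.congr fun m => ?_
    simp only [Function.comp_apply, pow_one]
    congr 1
    ring
  have h := (hx.inv_tendsto_atTop.mul_const b).add (hlog.const_mul (N:ℝ))
  simp only [zero_mul, mul_zero, add_zero] at h
  refine h.congr fun m => ?_
  simp only [Pi.inv_apply]
  ring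

lemma tendsto_poly_mul_exp (N : ℕ) {C c : ℝ} (hC : 0 < C) (hc : 0 < c) :
    Tendsto (fun m : ℕ => C * ((m:ℝ)+2) ^ N * Real.exp (-((m+1) * c))) atTop (nhds 0) := by
  have hx : Tendsto (fun m : ℕ => (m:ℝ)+1) atTop atTop :=
    tendsto_atTop_add_const_right _ _ tendsto_natCast_atTop_atTop
  have h := (tendsto_log_div N (Real.log C)).sub_const c
  have h2 : Tendsto (fun m : ℕ => Real.exp (((m:ℝ)+1) *
      (((m:ℝ)+1)⁻¹ * (Real.log C + N * Real.log ((m:ℝ)+2)) - c))) atTop (nhds 0) :=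
    Real.tendsto_exp_atBot.comp (hx.atTop_mul_neg (by linarith) h)
  refine h2.congr fun m => ?_
  have hm : (m:ℝ) + 1 ≠ 0 := by positivity
  have hm2 : (0:ℝ) < (m:ℝ) + 2 := by positivity
  rw [mul_sub, mul_inv_cancel_left₀ hm, sub_eq_add_neg, Real.exp_add, Real.exp_add,
    Real.exp_log hC, Real.exp_nat_mul, Real.exp_log hm2]

lemma eventually_le_prCyc_of_pos [Nonempty (Fin n)] {μ ν : Fin n → Fin n → ℝ}
    (hpos : ∀ i j, 0 < μ i j) (hν : ν ∈ Ms2 n)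
    (hνpos : ∀ i j, 0 < ν i j) {S : Set (Fin n → Fin n → ℝ)} (hS : IsOpen S) (hνS : ν ∈ S)
    {d : ℝ} (hd : Dc ν μ < d) :
    ∃ a > 0, ∀ᶠ m : ℕ in atTop, a * Real.exp (-((m+1) * d)) ≤ prCyc μ m S := by
  set F : (Fin n → Fin n → ℝ) → ℝ := fun ξ =>
    ∑ i, ∑ j, ξ i j * (Real.log (kern ν i j) - Real.log (kern μ i j)) with hF
  have hFc : Continuous F := by
    rw [hF]
    fun_prop
  set S' := S ∩ {ξ | F ξ < d}
  have hS'o : IsOpen S' := hS.inter (isOpen_lt hFc continuous_const)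
  have hνS' : ν ∈ S' := ⟨hνS, (Dc_eq_sum hν.1.1 hpos).symm.trans_lt hd⟩
  have hcompl : ∃ c > 0, ∀ ξ ∈ Ms2 n, ξ ∈ S'ᶜ → c ≤ Dc ξ ν := by
    rcases (Ms2 n ∩ S'ᶜ).eq_empty_or_nonempty with h | h
    · exact ⟨1, one_pos, fun ξ h1 h2 => absurd (h ▸ ⟨h1, h2⟩ : ξ ∈ (∅ : Set _)) (by simp)⟩
    · obtain ⟨ξ, hξ, hmin⟩ := (isCompact_Ms2.inter_right hS'o.isClosed_compl).exists_isMinOn h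
        (continuous_Dc hνpos).continuousOn
      refine ⟨Dc ξ ν, Dc_pos hξ.1 hν hνpos ?_, fun ζ h1 h2 => hmin ⟨h1, h2⟩⟩
      rintro rfl
      exact hξ.2 hνS'
  obtain ⟨c, hc, hcD⟩ := hcompl
  obtain ⟨C, hC, hupper⟩ := exists_prCyc_le hν hνpos
  obtain ⟨a, ha, hlow⟩ := exists_pos_le_cycWeight hpos
  obtain ⟨b, hb, hlow'⟩ := exists_pos_mul_pathP_le hν hνpos
  refine ⟨a * b * (1/2), by positivity, ?_⟩
  filter_upwards [(tendsto_poly_mul_exp (n*n) hC hc).eventually_lt_const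
    (show (0:ℝ) < 1/2 by norm_num)] with m hm
  have hhalf : 1/2 ≤ prCyc ν m S' := by
    have h1 := hupper m S'ᶜ c hcD
    have h2 := prCyc_add_compl hν hνpos m S'
    linarith
  have hterm : ∀ x : Fin (m+1) → Fin n, cycEmp x ∈ S' →
      a * b * Real.exp (-((m+1) * d)) * pathP ν x ≤ pathP μ x := fun x hx => by
    refine le_trans ?_ (hlow m x)
    have hw : Real.exp (-((m+1) * d)) * cycWeight (kern ν) x ≤ cycWeight (kern μ) x := by
      rw [cycWeight_eq_exp x (kern ν) fun i j _ => kern_pos hνpos i j,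
        cycWeight_eq_exp x (kern μ) fun i j _ => kern_pos hpos i j, ← Real.exp_add,
        Real.exp_le_exp]
      have hFx : F (cycEmp x) = ∑ i, ∑ j, cycEmp x i j * Real.log (kern ν i j)
          - ∑ i, ∑ j, cycEmp x i j * Real.log (kern μ i j) := by
        simp only [hF, mul_sub, Finset.sum_sub_distrib]
      have hx2 : F (cycEmp x) ≤ d := le_of_lt hx.2
      have hm0 : (0:ℝ) ≤ m + 1 := by positivity
      have := mul_le_mul_of_nonneg_left hx2 hm0
      rw [hFx] at this
      linarith
    calc a * b * Real.exp (-((m+1) * d)) * pathP ν x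
        = a * (Real.exp (-((m+1) * d)) * (b * pathP ν x)) := by ring
      _ ≤ a * (Real.exp (-((m+1) * d)) * cycWeight (kern ν) x) := by
          have := hlow' m x
          gcongr
      _ ≤ a * cycWeight (kern μ) x := by gcongr
  calc a * b * (1/2) * Real.exp (-((m+1) * d))
      = a * b * Real.exp (-((m+1) * d)) * (1/2) := by ring
    _ ≤ a * b * Real.exp (-((m+1) * d)) * prCyc ν m S' := by gcongr
    _ ≤ prCyc μ m S := by
        rw [prCyc, prCyc, Finset.mul_sum]
        refine Finset.sum_le_sum fun x _ => ?_
        by_cases h : cycEmp x ∈ S'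
        · rw [if_pos h, if_pos h.1]
          exact hterm x h
        · rw [if_neg h, mul_zero]
          split_ifs
          · exact pathP_nonneg hpos x
          · exact le_rfl

lemma eventually_le_prCyc [Nonempty (Fin n)] {μ ν : Fin n → Fin n → ℝ} (hμ : μ ∈ Ms2 n)
    (hpos : ∀ i j, 0 < μ i j) (hν : ν ∈ Ms2 n)
    {S : Set (Fin n → Fin n → ℝ)} (hS : IsOpen S) (hνS : ν ∈ S)
    {d : ℝ} (hd : Dc ν μ < d) :
    ∃ a > 0, ∀ᶠ m : ℕ in atTop, a * Real.exp (-((m+1) * d)) ≤ prCyc μ m S := by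
  set p : ℝ → Fin n → Fin n → ℝ := fun ε i j => (1 - ε) * ν i j + ε * μ i j with hp
  have hpc : Continuous p := by
    rw [hp]
    fun_prop
  have hp0 : p 0 = ν := by simp [hp]
  have hU : IsOpen (S ∩ {ξ | Dc ξ μ < d}) :=
    hS.inter (isOpen_lt (continuous_Dc hpos) continuous_const)
  have hmem : ∀ᶠ ε in nhds (0:ℝ), p ε ∈ S ∩ {ξ | Dc ξ μ < d} :=
    hpc.continuousAt.eventually (hU.mem_nhds (by rw [hp0]; exact ⟨hνS, hd⟩))
  obtain ⟨ε, ⟨hε, hεd⟩, hε0, hε1⟩ :=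
    ((hmem.filter_mono nhdsWithin_le_nhds).and
      (Ioo_mem_nhdsGT (show (0:ℝ) < 1 by norm_num))).exists
  have hε1' : 0 ≤ 1 - ε := by linarith
  have hppos : ∀ i j, 0 < p ε i j := fun i j =>
    add_pos_of_nonneg_of_pos (mul_nonneg hε1' (hν.1.1 i j)) (mul_pos hε0 (hpos i j))
  have hpM : p ε ∈ Ms2 n := by
    refine ⟨⟨fun i j => (hppos i j).le, ?_⟩, fun i => ?_⟩
    · simp only [hp, Finset.sum_add_distrib, ← Finset.mul_sum, hν.1.2, hμ.1.2]
      ring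
    · simp only [hp, Finset.sum_add_distrib, ← Finset.mul_sum, hν.2 i, hμ.2 i]
  exact eventually_le_prCyc_of_pos hpos hpM hppos hS hε hεd

lemma inv_mul_elog_mono (m : ℕ) {p q : ℝ} (h : p ≤ q) :
    ((((m:ℝ)+1)⁻¹ : ℝ) : EReal) * elog p ≤ ((((m:ℝ)+1)⁻¹ * Real.log q : ℝ) : EReal) := by
  have hm : (0:ℝ) < ((m:ℝ)+1)⁻¹ := by positivity
  unfold elog
  split_ifs with hp
  · rw [EReal.coe_mul_bot_of_pos hm]
    exact bot_le
  · rw [← EReal.coe_mul, EReal.coe_le_coe_iff]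
    exact mul_le_mul_of_nonneg_left (Real.log_le_log (not_le.1 hp) h) hm.le

lemma le_inv_mul_elog (m : ℕ) {p q : ℝ} (h : q ≤ p) (hq : 0 < q) :
    ((((m:ℝ)+1)⁻¹ * Real.log q : ℝ) : EReal) ≤ ((((m:ℝ)+1)⁻¹ : ℝ) : EReal) * elog p := by
  rw [elog, if_neg (hq.trans_le h).not_ge, ← EReal.coe_mul, EReal.coe_le_coe_iff]
  exact mul_le_mul_of_nonneg_left (Real.log_le_log hq h) (by positivity)

lemma tendsto_inv_mul_log (N : ℕ) {C : ℝ} (hC : 0 < C) (c : ℝ) :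
    Tendsto (fun m : ℕ => (((((m:ℝ)+1)⁻¹ *
      Real.log (C * ((m:ℝ)+2) ^ N * Real.exp (-((m+1) * c))) : ℝ)) : EReal)) atTop
      (nhds ((-c : ℝ) : EReal)) := by
  refine (continuous_coe_real_ereal.tendsto _).comp ?_
  have h := (tendsto_log_div N (Real.log C)).sub_const c
  rw [zero_sub] at h
  refine h.congr fun m => ?_
  have hm2 : (0:ℝ) < (m:ℝ) + 2 := by positivity
  rw [Real.log_mul (by positivity) (Real.exp_pos _).ne', Real.log_mul hC.ne' (by positivity),
    Real.log_pow, Real.log_exp]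
  have hm : (m:ℝ) + 1 ≠ 0 := by positivity
  field_simp
  ring

end Bounds

/-- For a stationary Markov chain with strictly positive doublet
frequency vector `μ ∈ M_s(A²)`, the empirical singleton measures satisfy the LDP with
rate function `J(φ) = inf { D_c(ν‖μ) : ν ∈ M_s(A²), ν̄ = φ }`. -/
theorem stmt17 {n : ℕ} (μ : Fin n → Fin n → ℝ)
    (hμ : μ ∈ Ms2 n) (hpos : ∀ i j, 0 < μ i j) :
    (∀ Γ : Set (Fin n → ℝ), Γ ⊆ simplex n → OpenInV (simplex n) Γ →
      -(⨅ φ ∈ Γ, Jrate μ φ)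
        ≤ Filter.liminf
            (fun m : ℕ => ((((m:ℝ)+1)⁻¹ : ℝ) : EReal) * elog (prEvent1 μ m Γ))
            Filter.atTop) ∧
    (∀ Γ : Set (Fin n → ℝ), Γ ⊆ simplex n → ClosedInV (simplex n) Γ →
      Filter.limsup
          (fun m : ℕ => ((((m:ℝ)+1)⁻¹ : ℝ) : EReal) * elog (prEvent1 μ m Γ))
          Filter.atTop
        ≤ -(⨅ φ ∈ Γ, Jrate μ φ)) := by
  have hne : Nonempty (Fin n) := by
    by_contra h
    rw [not_nonempty_iff] at h
    have := hμ.1.2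
    simp at this
  refine ⟨fun Γ _ hΓ => ?_, fun Γ _ _ => ?_⟩
  · rw [EReal.neg_le]
    refine le_iInf₂ fun φ hφ => le_iInf₂ fun ν hν => ?_
    obtain ⟨hνM, rfl⟩ := hν
    rw [EReal.neg_le]
    obtain ⟨ε, hε, hball⟩ := hΓ _ hφ
    set S : Set (Fin n → Fin n → ℝ) := {ξ | dist1v (marg ξ) (marg ν) < ε} with hSdef
    have hS : IsOpen S := by
      refine isOpen_lt ?_ continuous_const
      unfold dist1v
      exact continuous_finsetSum _ fun i _ => ((continuous_marg i).sub continuous_const).abs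
    have hνS : ν ∈ S := by simpa [hSdef, dist1v] using hε
    rw [← EReal.coe_neg]
    refine EReal.ge_of_forall_gt_iff_ge.1 fun z hz => ?_
    have hd : Dc ν μ < -z := by
      rw [EReal.coe_lt_coe_iff] at hz
      linarith
    obtain ⟨a, ha, hev⟩ := eventually_le_prCyc hμ hpos hνM hS hνS hd
    have ht := tendsto_inv_mul_log 0 ha (-z)
    rw [neg_neg] at ht
    rw [← ht.liminf_eq]
    refine Filter.liminf_le_liminf (hev.mono fun m hm => ?_)
    refine le_inv_mul_elog m ?_ (by positivity)
    rw [pow_zero, mul_one]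
    refine hm.trans ?_
    rw [prEvent1_eq_prCyc, prCyc, prCyc]
    refine Finset.sum_le_sum fun x _ => ?_
    by_cases h : cycEmp x ∈ S
    · have h' : cycEmp x ∈ {ξ | marg ξ ∈ Γ} :=
        hball _ (marg_mem_simplex (cycEmp_mem_Ms2 x)) h
      rw [if_pos h, if_pos h']
    · rw [if_neg h]
      split_ifs
      · exact pathP_nonneg hpos x
      · exact le_rfl
  · obtain ⟨C, hC, hupper⟩ := exists_prCyc_le hμ hpos
    rw [EReal.le_neg]
    refine EReal.ge_of_forall_gt_iff_ge.1 fun c hc => ?_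
    rw [EReal.le_neg, ← EReal.coe_neg, ← (tendsto_inv_mul_log (n*n) hC c).limsup_eq]
    refine Filter.limsup_le_limsup (Eventually.of_forall fun m => ?_)
    refine inv_mul_elog_mono m ?_
    rw [prEvent1_eq_prCyc]
    refine hupper m _ c fun ξ hξ hξΓ => ?_
    rw [← EReal.coe_le_coe_iff]
    exact hc.le.trans ((iInf₂_le (marg ξ) hξΓ).trans (iInf₂_le ξ ⟨hξ, rfl⟩))
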